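/- arXiv:2405.03629 — 6 statements merged into one kernel-verified Lean document; each statement's English description precedes it below -/
import Mathlib

section
/- Let (y,u,y⁺) ∈ 𝕊, let λ ∈ ℝ^v satisfy λ_j ≥ 0 for all j and Σ_{j=1}^v λ_j = 1, and set x := Σ_{j=1}^v λ_j V_j y and u_x := Σ_{j=1}^v λ_j U_j u. Then u_x ∈ 𝒰, and for every pair (A,B) ∈ Δ and every w ∈ 𝒲 one has F(A x + B u_x + w) ≤ y⁺ componentwise, i.e. A x + B u_x + w ∈ X(y⁺). -/
open Matrix

/-- The constraint set `𝕊` of tube parameters `(y, u, y⁺)`. -/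
def Sset {n nu m p v q : ℕ}
    (A : Fin p → Matrix (Fin n) (Fin n) ℝ)
    (B : Fin p → Matrix (Fin n) (Fin nu) ℝ)
    (SX : Set (Fin n → ℝ)) (SU : Set (Fin nu → ℝ))
    (F : Matrix (Fin m) (Fin n) ℝ)
    (E : Matrix (Fin q) (Fin m) ℝ)
    (V : Fin v → Matrix (Fin n) (Fin m) ℝ)
    (U : Fin v → Matrix (Fin nu) (Fin (v * nu)) ℝ)
    (d : Fin m → ℝ) :
    Set ((Fin m → ℝ) × (Fin (v * nu) → ℝ) × (Fin m → ℝ)) :=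
  {s | (∀ (i : Fin p) (j : Fin v),
        F.mulVec ((A i).mulVec ((V j).mulVec s.1) + (B i).mulVec ((U j).mulVec s.2.1)) + d
          ≤ s.2.2)
    ∧ E.mulVec s.1 ≤ 0
    ∧ (∀ j : Fin v, (V j).mulVec s.1 ∈ SX)
    ∧ (∀ j : Fin v, (U j).mulVec s.2.1 ∈ SU)}

/-- The multiplicative-uncertainty set `Δ = convh {(A₁,B₁),…,(A_p,B_p)}`. -/
def Delta {n nu p : ℕ}
    (A : Fin p → Matrix (Fin n) (Fin n) ℝ)
    (B : Fin p → Matrix (Fin n) (Fin nu) ℝ) :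
    Set (Matrix (Fin n) (Fin n) ℝ × Matrix (Fin n) (Fin nu) ℝ) :=
  {AB | ∃ θ : Fin p → ℝ, (∀ i, 0 ≤ θ i) ∧ (∑ i, θ i) = 1 ∧
    AB.1 = ∑ i, θ i • A i ∧ AB.2 = ∑ i, θ i • B i}

/-- The parametric polytope `X(y) = {x : F x ≤ y}`. -/
def Xset {n m : ℕ} (F : Matrix (Fin m) (Fin n) ℝ) (y : Fin m → ℝ) : Set (Fin n → ℝ) :=
  {x | F.mulVec x ≤ y}

theorem convex_Xset {n m : ℕ} (F : Matrix (Fin m) (Fin n) ℝ) (y : Fin m → ℝ) :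
    Convex ℝ (Xset F y) :=
  (convex_Iic y).linear_preimage F.mulVecLin

/-- A bound on all vertex pairs `(A i, B i)` at all points `(a j, b j)` extends to the convex
combinations of both. -/
theorem mulVec_add_mulVec_mem_of_mem_Delta {n nu p v : ℕ}
    {A : Fin p → Matrix (Fin n) (Fin n) ℝ} {B : Fin p → Matrix (Fin n) (Fin nu) ℝ}
    {AB : Matrix (Fin n) (Fin n) ℝ × Matrix (Fin n) (Fin nu) ℝ} (hAB : AB ∈ Delta A B)
    {a : Fin v → Fin n → ℝ} {b : Fin v → Fin nu → ℝ} {Z : Set (Fin n → ℝ)} (hZ : Convex ℝ Z)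
    (h : ∀ i j, (A i).mulVec (a j) + (B i).mulVec (b j) ∈ Z)
    {lam : Fin v → ℝ} (hlam : ∀ j, 0 ≤ lam j) (hsum : ∑ j, lam j = 1) :
    AB.1.mulVec (∑ j, lam j • a j) + AB.2.mulVec (∑ j, lam j • b j) ∈ Z := by
  obtain ⟨θ, hθ, hθsum, hA, hB⟩ := hAB
  have key : ∀ j, AB.1.mulVec (a j) + AB.2.mulVec (b j) ∈ Z := by
    intro j
    have hmem := hZ.sum_mem (fun i _ => hθ i) hθsum (fun i _ => h i j)
    simpa only [hA, hB, sum_mulVec, smul_mulVec, smul_add, Finset.sum_add_distrib] using hmem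
  have hmem := hZ.sum_mem (fun j _ => hlam j) hsum (fun j _ => key j)
  simpa only [mulVec_sum, mulVec_smul, smul_add, Finset.sum_add_distrib] using hmem

/-- If `(y,u,y⁺) ∈ 𝕊` and `λ ≥ 0` sums to one, then the convex combination
`u_x = Σ_j λ_j U_j u` is an admissible input, and for every `(A,B) ∈ Δ` and `w ∈ 𝒲`,
`A x + B u_x + w ∈ X(y⁺)` where `x = Σ_j λ_j V_j y`. -/
theorem vertex_control_one_step
    {n nu m p v q : ℕ}
    (A : Fin p → Matrix (Fin n) (Fin n) ℝ)
    (B : Fin p → Matrix (Fin n) (Fin nu) ℝ)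
    (W SX : Set (Fin n → ℝ)) (SU : Set (Fin nu → ℝ))
    (hW : Convex ℝ W) (hSX : Convex ℝ SX) (hSU : Convex ℝ SU)
    (F : Matrix (Fin m) (Fin n) ℝ)
    (E : Matrix (Fin q) (Fin m) ℝ)
    (V : Fin v → Matrix (Fin n) (Fin m) ℝ)
    (U : Fin v → Matrix (Fin nu) (Fin (v * nu)) ℝ)
    (d : Fin m → ℝ)
    (hd : ∀ w ∈ W, F.mulVec w ≤ d)
    (y : Fin m → ℝ) (u : Fin (v * nu) → ℝ) (yp : Fin m → ℝ)
    (hS : (y, u, yp) ∈ Sset A B SX SU F E V U d)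
    (lam : Fin v → ℝ) (hlam : ∀ j, 0 ≤ lam j) (hsum : (∑ j, lam j) = 1)
    (x : Fin n → ℝ) (hx : x = ∑ j, lam j • (V j).mulVec y)
    (ux : Fin nu → ℝ) (hux : ux = ∑ j, lam j • (U j).mulVec u) :
    ux ∈ SU ∧
      ∀ AB ∈ Delta A B, ∀ w ∈ W,
        AB.1.mulVec x + AB.2.mulVec ux + w ∈ Xset F yp := by
  obtain ⟨hstep, -, -, hU⟩ := hS
  subst hx hux
  refine ⟨hSU.sum_mem (fun j _ => hlam j) hsum fun j _ => hU j, fun AB hAB w hw => ?_⟩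
  have hmem := mulVec_add_mulVec_mem_of_mem_Delta hAB (convex_Xset F (yp - d))
    (fun i j => le_sub_iff_add_le.mpr (hstep i j)) hlam hsum
  change F.mulVec (_ + w) ≤ yp
  rw [mulVec_add]
  exact (add_le_add (show _ ≤ yp - d from hmem) (hd w hw)).trans_eq (sub_add_cancel yp d)
end

section
/- (Feasibility propagation, equation (13) of the paper.) Let γ ∈ [0,1]. Suppose (y_s, u_s, y_s) ∈ 𝕊 and (ȳ, ū, γ·ȳ + (1−γ)·y_s) ∈ 𝕊. Define ȳ⁺ := γ·ȳ + (1−γ)·y_s and ū⁺ := γ·ū + (1−γ)·u_s. Then (ȳ⁺, ū⁺, γ·ȳ⁺ + (1−γ)·y_s) ∈ 𝕊. -/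
open Matrix

/-- The constraint set `𝕊` is convex as soon as the state and input constraint sets are. -/
theorem convex_Sset {n nu m p v q : ℕ}
    (A : Fin p → Matrix (Fin n) (Fin n) ℝ)
    (B : Fin p → Matrix (Fin n) (Fin nu) ℝ)
    {SX : Set (Fin n → ℝ)} {SU : Set (Fin nu → ℝ)}
    (hSX : Convex ℝ SX) (hSU : Convex ℝ SU)
    (F : Matrix (Fin m) (Fin n) ℝ)
    (E : Matrix (Fin q) (Fin m) ℝ)
    (V : Fin v → Matrix (Fin n) (Fin m) ℝ)
    (U : Fin v → Matrix (Fin nu) (Fin (v * nu)) ℝ)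
    (d : Fin m → ℝ) :
    Convex ℝ (Sset A B SX SU F E V U d) := by
  rintro ⟨y, u, z⟩ ⟨hz, hE, hX, hU⟩ ⟨y', u', z'⟩ ⟨hz', hE', hX', hU'⟩ a b ha hb hab
  refine ⟨fun i j k => ?_, fun k => ?_, fun j => ?_, fun j => ?_⟩
  · have h := mul_le_mul_of_nonneg_left (hz i j k) ha
    have h' := mul_le_mul_of_nonneg_left (hz' i j k) hb
    have hd : d k = a * d k + b * d k := by rw [← add_mul, hab, one_mul]
    simp only [Prod.smul_mk, Prod.mk_add_mk, mulVec_add, mulVec_smul, Pi.add_apply,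
      Pi.smul_apply, smul_eq_mul] at h h' ⊢
    linarith
  · have h := mul_nonpos_of_nonneg_of_nonpos ha (hE k)
    have h' := mul_nonpos_of_nonneg_of_nonpos hb (hE' k)
    simp only [Prod.smul_mk, Prod.mk_add_mk, mulVec_add, mulVec_smul, Pi.add_apply,
      Pi.smul_apply, smul_eq_mul, Pi.zero_apply] at h h' ⊢
    linarith
  · simpa only [Prod.smul_mk, Prod.mk_add_mk, mulVec_add, mulVec_smul]
      using hSX (hX j) (hX' j) ha hb hab
  · simpa only [Prod.smul_mk, Prod.mk_add_mk, mulVec_add, mulVec_smul]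
      using hSU (hU j) (hU' j) ha hb hab

/-- **feasibility propagation, eq. (13).** If `(y_s,u_s,y_s) ∈ 𝕊` and
`(ȳ, ū, γȳ + (1−γ)y_s) ∈ 𝕊`, then the pair `ȳ⁺ = γȳ + (1−γ)y_s`, `ū⁺ = γū + (1−γ)u_s`
satisfies `(ȳ⁺, ū⁺, γȳ⁺ + (1−γ)y_s) ∈ 𝕊`. -/
theorem Sset_feasibility_propagation
    {n nu m p v q : ℕ}
    (A : Fin p → Matrix (Fin n) (Fin n) ℝ)
    (B : Fin p → Matrix (Fin n) (Fin nu) ℝ)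
    (W SX : Set (Fin n → ℝ)) (SU : Set (Fin nu → ℝ))
    (hW : Convex ℝ W) (hSX : Convex ℝ SX) (hSU : Convex ℝ SU)
    (F : Matrix (Fin m) (Fin n) ℝ)
    (E : Matrix (Fin q) (Fin m) ℝ)
    (V : Fin v → Matrix (Fin n) (Fin m) ℝ)
    (U : Fin v → Matrix (Fin nu) (Fin (v * nu)) ℝ)
    (d : Fin m → ℝ)
    (hd : ∀ w ∈ W, F.mulVec w ≤ d)
    (γ : ℝ) (hγ0 : 0 ≤ γ) (hγ1 : γ ≤ 1)
    (ys : Fin m → ℝ) (us : Fin (v * nu) → ℝ)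
    (hys : (ys, us, ys) ∈ Sset A B SX SU F E V U d)
    (yb : Fin m → ℝ) (ub : Fin (v * nu) → ℝ)
    (hyb : (yb, ub, γ • yb + (1 - γ) • ys) ∈ Sset A B SX SU F E V U d) :
    (γ • yb + (1 - γ) • ys, γ • ub + (1 - γ) • us,
        γ • (γ • yb + (1 - γ) • ys) + (1 - γ) • ys) ∈ Sset A B SX SU F E V U d := by
  exact convex_Sset A B hSX hSU F E V U d hyb hys hγ0 (sub_nonneg.2 hγ1) (add_sub_cancel γ 1)
end

section
/- (Invariance of the implicit terminal set.) Let γ ∈ [0,1] and suppose (y_s, u_s, y_s) ∈ 𝕊. Define the terminal set 𝕋(y_s, u_s) := {y ∈ ℝ^m : ∃ u ∈ ℝ^{v·nu}, (y, u, γ·y + (1−γ)·y_s) ∈ 𝕊}. If ȳ ∈ 𝕋(y_s, u_s), then γ·ȳ + (1−γ)·y_s ∈ 𝕋(y_s, u_s). -/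
open Matrix

/-- **invariance of the implicit terminal set.** If
`𝕋(y_s,u_s) = {y : ∃ u, (y, u, γy + (1−γ)y_s) ∈ 𝕊}` and `ȳ ∈ 𝕋(y_s,u_s)`, then
`γȳ + (1−γ)y_s ∈ 𝕋(y_s,u_s)`. -/
theorem terminal_set_invariant
    {n nu m p v q : ℕ}
    (A : Fin p → Matrix (Fin n) (Fin n) ℝ)
    (B : Fin p → Matrix (Fin n) (Fin nu) ℝ)
    (W SX : Set (Fin n → ℝ)) (SU : Set (Fin nu → ℝ))
    (hW : Convex ℝ W) (hSX : Convex ℝ SX) (hSU : Convex ℝ SU)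
    (F : Matrix (Fin m) (Fin n) ℝ)
    (E : Matrix (Fin q) (Fin m) ℝ)
    (V : Fin v → Matrix (Fin n) (Fin m) ℝ)
    (U : Fin v → Matrix (Fin nu) (Fin (v * nu)) ℝ)
    (d : Fin m → ℝ)
    (hd : ∀ w ∈ W, F.mulVec w ≤ d)
    (γ : ℝ) (hγ0 : 0 ≤ γ) (hγ1 : γ ≤ 1)
    (ys : Fin m → ℝ) (us : Fin (v * nu) → ℝ)
    (hys : (ys, us, ys) ∈ Sset A B SX SU F E V U d)
    (yb : Fin m → ℝ)
    (hyb : ∃ u : Fin (v * nu) → ℝ,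
      (yb, u, γ • yb + (1 - γ) • ys) ∈ Sset A B SX SU F E V U d) :
    ∃ u : Fin (v * nu) → ℝ,
      (γ • yb + (1 - γ) • ys, u,
        γ • (γ • yb + (1 - γ) • ys) + (1 - γ) • ys) ∈ Sset A B SX SU F E V U d := by
  obtain ⟨u, hu⟩ := hyb
  exact ⟨γ • u + (1 - γ) • us,
    convex_Sset A B hSX hSU F E V U d hu hys hγ0 (sub_nonneg.2 hγ1) (add_sub_cancel γ 1)⟩
end

section
/- (Corollary 1(i): recursive feasibility of the tracking CCTMPC problem, for arbitrary realizations of uncertainty and arbitrary reference changes.) Let γ ∈ [0,1] and N ≥ 1, and assume the vertex representation: for every y ∈ ℝ^m with E y ≤ 0, X(y) equals the convex hull of {V_1 y, …, V_v y}. Let (y_0,…,y_N, u_0,…,u_N, y_s, u_s) be feasible for a state x ∈ ℝ^n. Then there exists λ ∈ ℝ^v with λ ≥ 0, Σ_j λ_j = 1 and x = Σ_j λ_j V_j y_0; moreover, for any such λ, setting μ := Σ_j λ_j U_j u_0, for every (A,B) ∈ Δ and every w ∈ 𝒲 the shifted tuple (y_1,…,y_N, ỹ, u_1,…,u_N, ũ,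 y_s, u_s), with ỹ := γ·y_N + (1−γ)·y_s and ũ := γ·u_N + (1−γ)·u_s, is feasible for the successor state x⁺ := A x + B μ + w. -/
open Matrix

/-- Feasibility of a tuple `(y_0,…,y_N, u_0,…,u_N, y_s, u_s)` for a state `x` in the tracking
CCTMPC problem with horizon `N` and terminal contraction factor `γ`. -/
def Feasible {n m k : ℕ} (γ : ℝ) (N : ℕ)
    (S : Set ((Fin m → ℝ) × (Fin k → ℝ) × (Fin m → ℝ)))
    (F : Matrix (Fin m) (Fin n) ℝ)
    (x : Fin n → ℝ)
    (y : Fin (N + 1) → Fin m → ℝ) (u : Fin (N + 1) → Fin k → ℝ)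
    (ys : Fin m → ℝ) (us : Fin k → ℝ) : Prop :=
  F.mulVec x ≤ y 0 ∧ (ys, us, ys) ∈ S ∧
    (∀ i : Fin N, (y i.castSucc, u i.castSucc, y i.succ) ∈ S) ∧
    (y (Fin.last N), u (Fin.last N), γ • y (Fin.last N) + (1 - γ) • ys) ∈ S

/-- The tracking MPC objective
`ℓ(y_s,u_s) + Σ_{k=0}^{N−1} ‖(y_k−y_s, u_k−u_s)‖_Q² + ‖(y_N−y_s, u_N−u_s)‖_P²`. -/
noncomputable def Obj {m k : ℕ} (N : ℕ)
    (Q P : Matrix (Fin m ⊕ Fin k) (Fin m ⊕ Fin k) ℝ)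
    (l : (Fin m → ℝ) → (Fin k → ℝ) → ℝ)
    (y : Fin (N + 1) → Fin m → ℝ) (u : Fin (N + 1) → Fin k → ℝ)
    (ys : Fin m → ℝ) (us : Fin k → ℝ) : ℝ :=
  l ys us
    + ∑ i : Fin N,
        Sum.elim (y i.castSucc - ys) (u i.castSucc - us) ⬝ᵥ
          Q.mulVec (Sum.elim (y i.castSucc - ys) (u i.castSucc - us))
    + Sum.elim (y (Fin.last N) - ys) (u (Fin.last N) - us) ⬝ᵥ
        P.mulVec (Sum.elim (y (Fin.last N) - ys) (u (Fin.last N) - us))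

theorem mem_convexHull_range_iff {ι M : Type*} [Fintype ι] [AddCommGroup M] [Module ℝ M]
    {f : ι → M} {x : M} :
    x ∈ convexHull ℝ (Set.range f) ↔
      ∃ lam : ι → ℝ, (∀ j, 0 ≤ lam j) ∧ ∑ j, lam j = 1 ∧ x = ∑ j, lam j • f j := by
  classical
  have h := (Fintype.linearCombination ℝ f).image_convexHull
    (Set.range fun i j : ι => if i = j then (1 : ℝ) else 0)
  rw [convexHull_basis_eq_stdSimplex, ← Set.range_comp] at h
  have hf : (Fintype.linearCombination ℝ f ∘ fun i j : ι => if i = j then (1 : ℝ) else 0) = f := by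
    ext i
    simp [Fintype.linearCombination_apply]
  rw [hf] at h
  rw [← h]
  simp [stdSimplex, Fintype.linearCombination_apply, and_assoc, eq_comm]

/-- The set of states reachable in one step from a convex combination of the vertices `V_j y`,
under the corresponding combination of the vertex controls, lies in `X(y⁺)`. -/
theorem successor_mem_Xset {n nu m p v q : ℕ}
    {A : Fin p → Matrix (Fin n) (Fin n) ℝ}
    {B : Fin p → Matrix (Fin n) (Fin nu) ℝ}
    {SX : Set (Fin n → ℝ)} {SU : Set (Fin nu → ℝ)}
    {F : Matrix (Fin m) (Fin n) ℝ}
    {E : Matrix (Fin q) (Fin m) ℝ}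
    {V : Fin v → Matrix (Fin n) (Fin m) ℝ}
    {U : Fin v → Matrix (Fin nu) (Fin (v * nu)) ℝ}
    {d y y' : Fin m → ℝ} {u : Fin (v * nu) → ℝ}
    (hS : (y, u, y') ∈ Sset A B SX SU F E V U d)
    {w : Fin n → ℝ} (hw : F.mulVec w ≤ d)
    {lam : Fin v → ℝ} (hlam : ∀ j, 0 ≤ lam j) (hsum : ∑ j, lam j = 1)
    {AB : Matrix (Fin n) (Fin n) ℝ × Matrix (Fin n) (Fin nu) ℝ} (hAB : AB ∈ Delta A B) :
    AB.1.mulVec (∑ j, lam j • (V j).mulVec y) + AB.2.mulVec (∑ j, lam j • (U j).mulVec u) + w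
      ∈ Xset F y' := by
  obtain ⟨θ, hθ, hθsum, hA, hB⟩ := hAB
  have hvertex : ∀ i j,
      (A i).mulVec ((V j).mulVec y) + (B i).mulVec ((U j).mulVec u) ∈ Xset F (y' - d) :=
    fun i j => le_sub_iff_add_le.mpr (hS.1 i j)
  have hmem : ∑ i, θ i • ∑ j, lam j •
      ((A i).mulVec ((V j).mulVec y) + (B i).mulVec ((U j).mulVec u)) ∈ Xset F (y' - d) :=
    (convex_Xset F _).sum_mem (fun i _ => hθ i) hθsum fun i _ =>
      (convex_Xset F _).sum_mem (fun j _ => hlam j) hsum fun j _ => hvertex i j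
  have heq : AB.1.mulVec (∑ j, lam j • (V j).mulVec y) +
      AB.2.mulVec (∑ j, lam j • (U j).mulVec u) =
      ∑ i, θ i • ∑ j, lam j •
        ((A i).mulVec ((V j).mulVec y) + (B i).mulVec ((U j).mulVec u)) := by
    rw [hA, hB, sum_mulVec, sum_mulVec, ← Finset.sum_add_distrib]
    refine Finset.sum_congr rfl fun i _ => ?_
    simp only [smul_mulVec, mulVec_sum, mulVec_smul, smul_add, Finset.sum_add_distrib,
      Finset.smul_sum, smul_comm (θ i)]
  rw [← heq] at hmem
  change F.mulVec _ ≤ y'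
  rw [mulVec_add]
  simpa using add_le_add hmem hw

/-- **Corollary 1(i): recursive feasibility.** If a tuple is feasible for `x`,
then `x` is a convex combination of the vertices `V_j y_0`; and for any such convex weights
`λ`, the shifted candidate tuple is feasible for the successor state
`x⁺ = A x + B μ + w`, for every `(A,B) ∈ Δ` and `w ∈ 𝒲`. -/
theorem recursive_feasibility
    {n nu m p v q : ℕ}
    (A : Fin p → Matrix (Fin n) (Fin n) ℝ)
    (B : Fin p → Matrix (Fin n) (Fin nu) ℝ)
    (W SX : Set (Fin n → ℝ)) (SU : Set (Fin nu → ℝ))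
    (hW : Convex ℝ W) (hSX : Convex ℝ SX) (hSU : Convex ℝ SU)
    (F : Matrix (Fin m) (Fin n) ℝ)
    (E : Matrix (Fin q) (Fin m) ℝ)
    (V : Fin v → Matrix (Fin n) (Fin m) ℝ)
    (U : Fin v → Matrix (Fin nu) (Fin (v * nu)) ℝ)
    (d : Fin m → ℝ)
    (hd : ∀ w ∈ W, F.mulVec w ≤ d)
    (γ : ℝ) (hγ0 : 0 ≤ γ) (hγ1 : γ ≤ 1)
    (N : ℕ) (hN : 1 ≤ N)
    (hvert : ∀ y : Fin m → ℝ, E.mulVec y ≤ 0 →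
      Xset F y = convexHull ℝ (Set.range fun j : Fin v => (V j).mulVec y))
    (x : Fin n → ℝ)
    (y : Fin (N + 1) → Fin m → ℝ) (u : Fin (N + 1) → Fin (v * nu) → ℝ)
    (ys : Fin m → ℝ) (us : Fin (v * nu) → ℝ)
    (hfeas : Feasible γ N (Sset A B SX SU F E V U d) F x y u ys us) :
    (∃ lam : Fin v → ℝ, (∀ j, 0 ≤ lam j) ∧ (∑ j, lam j) = 1 ∧
        x = ∑ j, lam j • (V j).mulVec (y 0)) ∧
    (∀ lam : Fin v → ℝ, (∀ j, 0 ≤ lam j) → (∑ j, lam j) = 1 →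
      x = ∑ j, lam j • (V j).mulVec (y 0) →
      ∀ AB ∈ Delta A B, ∀ w ∈ W,
        Feasible γ N (Sset A B SX SU F E V U d) F
          (AB.1.mulVec x + AB.2.mulVec (∑ j, lam j • (U j).mulVec (u 0)) + w)
          (Fin.snoc (fun i : Fin N => y i.succ) (γ • y (Fin.last N) + (1 - γ) • ys))
          (Fin.snoc (fun i : Fin N => u i.succ) (γ • u (Fin.last N) + (1 - γ) • us))
          ys us) := by
  obtain ⟨hx, hs, hstep, hlast⟩ := hfeas
  obtain ⟨N, rfl⟩ : ∃ M, N = M + 1 := ⟨N - 1, by omega⟩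
  have hS₀ : (y 0, u 0, y 1) ∈ Sset A B SX SU F E V U d := hstep 0
  refine ⟨?_, fun lam hlam hsum hxlam AB hAB w hw => ⟨?_, hs, ?_, ?_⟩⟩
  · have hmem : x ∈ Xset F (y 0) := hx
    rw [hvert _ hS₀.2.1] at hmem
    exact mem_convexHull_range_iff.mp hmem
  · rw [hxlam]
    exact successor_mem_Xset hS₀ (hd w hw) hlam hsum hAB
  · intro i
    rw [Fin.snoc_castSucc, Fin.snoc_castSucc]
    induction i using Fin.lastCases with
    | last =>
      rw [Fin.succ_last, Fin.snoc_last]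
      exact hlast
    | cast i =>
      rw [Fin.succ_castSucc, Fin.snoc_castSucc]
      exact hstep i.succ
  · simp only [Fin.snoc_last]
    exact convex_Sset A B hSX hSU F E V U d hlast hs hγ0 (sub_nonneg.mpr hγ1)
      (add_sub_cancel _ _)
end

section
/- (Cost decrease of the shifted candidate, the key inequality behind Corollary 1(ii).) Let γ ∈ [0,1], N ≥ 1, and let Q and P be symmetric positive-semidefinite (m + v·nu)×(m + v·nu) real matrices satisfying zᵀ Q z + γ² · zᵀ P z ≤ zᵀ P z for all z ∈ ℝ^{m + v·nu}. Let ℓ : ℝ^m × ℝ^{v·nu} → ℝ be any function, and let (y_0,…,y_N, u_0,…,u_N, y_s, u_s) be any tuple (with the same y_s, u_s). Define ỹ := γ·y_N + (1−γ)·y_s and ũ := γ·u_N + (1−γ)·u_s. Then the shifted objective satisfies ℓ(y_s, u_s) + Σ_{k=1}^{N} ‖(y_k − y_s, u_k − u_s)‖_Q² + ‖(ỹ − y_s, ũ − u_s)‖_P² ≤ [ℓ(y_s, u_s) + Σ_{k=0}^{N−1} ‖(y_k − y_s, u_k − u_s)‖_Q² + ‖(y_N − y_s, u_N − u_s)‖_P²]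 − ‖(y_0 − y_s, u_0 − u_s)‖_Q². -/
open Matrix

/-- **cost decrease of the shifted candidate.** With `ỹ = γy_N + (1−γ)y_s`,
`ũ = γu_N + (1−γ)u_s` and `Q + γ²P ⪯ P` (as quadratic forms), the shifted objective is at most
the original objective minus the first stage cost. -/
theorem shifted_candidate_cost_decrease
    {m nu v : ℕ} (N : ℕ) (hN : 1 ≤ N)
    (γ : ℝ) (hγ0 : 0 ≤ γ) (hγ1 : γ ≤ 1)
    (Q P : Matrix (Fin m ⊕ Fin (v * nu)) (Fin m ⊕ Fin (v * nu)) ℝ)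
    (hQsymm : Q.IsSymm) (hPsymm : P.IsSymm)
    (hQpsd : ∀ z : Fin m ⊕ Fin (v * nu) → ℝ, 0 ≤ z ⬝ᵥ Q.mulVec z)
    (hPpsd : ∀ z : Fin m ⊕ Fin (v * nu) → ℝ, 0 ≤ z ⬝ᵥ P.mulVec z)
    (hQP : ∀ z : Fin m ⊕ Fin (v * nu) → ℝ,
      z ⬝ᵥ Q.mulVec z + γ ^ 2 * (z ⬝ᵥ P.mulVec z) ≤ z ⬝ᵥ P.mulVec z)
    (l : (Fin m → ℝ) → (Fin (v * nu) → ℝ) → ℝ)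
    (y : Fin (N + 1) → Fin m → ℝ) (u : Fin (N + 1) → Fin (v * nu) → ℝ)
    (ys : Fin m → ℝ) (us : Fin (v * nu) → ℝ) :
    l ys us
      + (∑ i : Fin N,
          Sum.elim (y i.succ - ys) (u i.succ - us) ⬝ᵥ
            Q.mulVec (Sum.elim (y i.succ - ys) (u i.succ - us)))
      + Sum.elim ((γ • y (Fin.last N) + (1 - γ) • ys) - ys)
            ((γ • u (Fin.last N) + (1 - γ) • us) - us) ⬝ᵥ
          P.mulVec (Sum.elim ((γ • y (Fin.last N) + (1 - γ) • ys) - ys)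
            ((γ • u (Fin.last N) + (1 - γ) • us) - us))
      ≤ (l ys us
          + (∑ i : Fin N,
              Sum.elim (y i.castSucc - ys) (u i.castSucc - us) ⬝ᵥ
                Q.mulVec (Sum.elim (y i.castSucc - ys) (u i.castSucc - us)))
          + Sum.elim (y (Fin.last N) - ys) (u (Fin.last N) - us) ⬝ᵥ
              P.mulVec (Sum.elim (y (Fin.last N) - ys) (u (Fin.last N) - us)))
        - Sum.elim (y 0 - ys) (u 0 - us) ⬝ᵥ
            Q.mulVec (Sum.elim (y 0 - ys) (u 0 - us)) := by
  have hshift : Sum.elim ((γ • y (Fin.last N) + (1 - γ) • ys) - ys)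
      ((γ • u (Fin.last N) + (1 - γ) • us) - us)
      = γ • Sum.elim (y (Fin.last N) - ys) (u (Fin.last N) - us) := by
    ext (i | i) <;> simp <;> ring
  have hterm := hQP (Sum.elim (y (Fin.last N) - ys) (u (Fin.last N) - us))
  have hsum := (Fin.sum_univ_succ fun k : Fin (N + 1) =>
    Sum.elim (y k - ys) (u k - us) ⬝ᵥ Q.mulVec (Sum.elim (y k - ys) (u k - us))).symm.trans
    (Fin.sum_univ_castSucc _)
  rw [hshift, mulVec_smul, smul_dotProduct, dotProduct_smul, smul_eq_mul, smul_eq_mul,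
    ← mul_assoc, ← pow_two]
  linarith
end

section
/- (Descent of the optimal value function along the closed loop, combining Corollary 1(i) and (ii).) Let γ ∈ [0,1), N ≥ 1, let Q and P be symmetric positive-semidefinite (m + v·nu)×(m + v·nu) real matrices with zᵀ Q z + γ² · zᵀ P z ≤ zᵀ P z for all z ∈ ℝ^{m + v·nu}, let ℓ : ℝ^m × ℝ^{v·nu} → ℝ be any function, and assume the vertex representation: for every y ∈ ℝ^m with E y ≤ 0, X(y) equals the convex hull of {V_1 y, …, V_v y}. For x ∈ ℝ^n define C*(x) := inf {J(T) : T a tuple feasible for x} ∈ [−∞, +∞], where J(T) := ℓ(y_s, u_s) + Σ_{k=0}^{N−1} ‖(y_k − y_s, u_k − u_s)‖_Q² + ‖(y_N − y_s, u_N − u_s)‖_P². Let (y_0,…,y_N, u_0,…,u_N, y_s, u_s) be feasible for x with objective value J, let λ ∈ ℝ^v satisfy λ ≥ 0, Σ_j λ_j = 1 and x = Σ_j λ_j V_j y_0, and set μ := Σ_j λ_j U_j u_0. Then for every (A,B) ∈ Δ and every w ∈ 𝒲, the successor state x⁺ := A x + B μ + w satisfies C*(x⁺) ≤ J − ‖(y_0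 − y_s, u_0 − u_s)‖_Q². -/
open Matrix

theorem convex_setOf_mulVec_le {n m : ℕ} (F : Matrix (Fin m) (Fin n) ℝ) (c : Fin m → ℝ) :
    Convex ℝ {z | F.mulVec z ≤ c} :=
  (convex_Iic c).linear_preimage F.mulVecLin

/-- Under a vertex control law, every successor state of the tube section lies in the next
section. -/
theorem mulVec_successor_le_of_mem_Sset {n nu m p v q : ℕ}
    {A : Fin p → Matrix (Fin n) (Fin n) ℝ}
    {B : Fin p → Matrix (Fin n) (Fin nu) ℝ}
    {SX : Set (Fin n → ℝ)} {SU : Set (Fin nu → ℝ)}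
    {F : Matrix (Fin m) (Fin n) ℝ}
    {E : Matrix (Fin q) (Fin m) ℝ}
    {V : Fin v → Matrix (Fin n) (Fin m) ℝ}
    {U : Fin v → Matrix (Fin nu) (Fin (v * nu)) ℝ}
    {d : Fin m → ℝ} {y ynext : Fin m → ℝ} {u : Fin (v * nu) → ℝ}
    (hS : (y, u, ynext) ∈ Sset A B SX SU F E V U d)
    {lam : Fin v → ℝ} (hlam : ∀ j, 0 ≤ lam j) (hlam1 : ∑ j, lam j = 1)
    {AB : Matrix (Fin n) (Fin n) ℝ × Matrix (Fin n) (Fin nu) ℝ} (hAB : AB ∈ Delta A B)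
    {w : Fin n → ℝ} (hw : F.mulVec w ≤ d) :
    F.mulVec (AB.1.mulVec (∑ j, lam j • (V j).mulVec y)
      + AB.2.mulVec (∑ j, lam j • (U j).mulVec u) + w) ≤ ynext := by
  obtain ⟨θ, hθ, hθ1, hA, hB⟩ := hAB
  have hC := convex_setOf_mulVec_le F (ynext - d)
  have hmem : ∑ i, θ i • ∑ j, lam j •
      ((A i).mulVec ((V j).mulVec y) + (B i).mulVec ((U j).mulVec u)) ∈
      {z | F.mulVec z ≤ ynext - d} :=
    hC.sum_mem (fun i _ => hθ i) hθ1 fun i _ =>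
      hC.sum_mem (fun j _ => hlam j) hlam1 fun j _ => le_sub_iff_add_le.2 (hS.1 i j)
  have heq : AB.1.mulVec (∑ j, lam j • (V j).mulVec y)
      + AB.2.mulVec (∑ j, lam j • (U j).mulVec u)
      = ∑ i, θ i • ∑ j, lam j •
        ((A i).mulVec ((V j).mulVec y) + (B i).mulVec ((U j).mulVec u)) := by
    simp only [hA, hB, sum_mulVec, smul_mulVec, mulVec_sum, mulVec_smul, smul_add,
      Finset.sum_add_distrib, Finset.smul_sum]
    congr 1 <;> rw [Finset.sum_comm] <;> simp only [smul_comm (lam _)]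
  rw [mulVec_add, heq]
  exact (add_le_add hmem hw).trans_eq (sub_add_cancel ynext d)

/-- Shifting a feasible tuple and appending the contracted terminal pair keeps it feasible for any
state in the second tube section. -/
theorem Feasible.shift {n m k M : ℕ} {γ : ℝ} (hγ0 : 0 ≤ γ) (hγ1 : γ ≤ 1)
    {S : Set ((Fin m → ℝ) × (Fin k → ℝ) × (Fin m → ℝ))} (hS : Convex ℝ S)
    {F : Matrix (Fin m) (Fin n) ℝ} {x x' : Fin n → ℝ}
    {y : Fin (M + 1 + 1) → Fin m → ℝ} {u : Fin (M + 1 + 1) → Fin k → ℝ}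
    {ys : Fin m → ℝ} {us : Fin k → ℝ}
    (h : Feasible γ (M + 1) S F x y u ys us) (hx' : F.mulVec x' ≤ y 1) :
    Feasible γ (M + 1) S F x'
      (Fin.snoc (α := fun _ => Fin m → ℝ) (fun i : Fin (M + 1) => y i.succ)
        (γ • y (Fin.last _) + (1 - γ) • ys))
      (Fin.snoc (α := fun _ => Fin k → ℝ) (fun i : Fin (M + 1) => u i.succ)
        (γ • u (Fin.last _) + (1 - γ) • us)) ys us := by
  obtain ⟨-, hs, hstep, hlast⟩ := h
  refine ⟨?_, hs, ?_, ?_⟩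
  · rw [← Fin.castSucc_zero, Fin.snoc_castSucc]
    exact hx'
  · intro i
    induction i using Fin.lastCases with
    | last =>
      rw [Fin.succ_last, Fin.snoc_castSucc, Fin.snoc_castSucc, Fin.snoc_last]
      exact hlast
    | cast j =>
      rw [Fin.succ_castSucc, Fin.snoc_castSucc, Fin.snoc_castSucc, Fin.snoc_castSucc,
        Fin.succ_castSucc]
      exact hstep j.succ
  · rw [Fin.snoc_last, Fin.snoc_last]
    exact hS hlast hs hγ0 (sub_nonneg.2 hγ1) (add_sub_cancel γ 1)

/-- The shifted tuple decreases the objective by at least the first stage cost. -/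
theorem Obj_shift_le {m k M : ℕ} {γ : ℝ}
    {Q P : Matrix (Fin m ⊕ Fin k) (Fin m ⊕ Fin k) ℝ}
    (hQP : ∀ z : Fin m ⊕ Fin k → ℝ,
      z ⬝ᵥ Q.mulVec z + γ ^ 2 * (z ⬝ᵥ P.mulVec z) ≤ z ⬝ᵥ P.mulVec z)
    (l : (Fin m → ℝ) → (Fin k → ℝ) → ℝ)
    (y : Fin (M + 1 + 1) → Fin m → ℝ) (u : Fin (M + 1 + 1) → Fin k → ℝ)
    (ys : Fin m → ℝ) (us : Fin k → ℝ) :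
    Obj (M + 1) Q P l
      (Fin.snoc (α := fun _ => Fin m → ℝ) (fun i : Fin (M + 1) => y i.succ)
        (γ • y (Fin.last _) + (1 - γ) • ys))
      (Fin.snoc (α := fun _ => Fin k → ℝ) (fun i : Fin (M + 1) => u i.succ)
        (γ • u (Fin.last _) + (1 - γ) • us)) ys us
      ≤ Obj (M + 1) Q P l y u ys us
        - Sum.elim (y 0 - ys) (u 0 - us) ⬝ᵥ Q.mulVec (Sum.elim (y 0 - ys) (u 0 - us)) := by
  have hterm : Sum.elim (γ • y (Fin.last _) + (1 - γ) • ys - ys)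
      (γ • u (Fin.last _) + (1 - γ) • us - us)
      = γ • Sum.elim (y (Fin.last _) - ys) (u (Fin.last _) - us) := by
    ext (i | i) <;> simp <;> ring
  have key := hQP (Sum.elim (y (Fin.last _) - ys) (u (Fin.last _) - us))
  simp only [Obj, Fin.snoc_castSucc, Fin.snoc_last, hterm, mulVec_smul, smul_dotProduct,
    dotProduct_smul, smul_eq_mul]
  rw [Fin.sum_univ_castSucc, Fin.sum_univ_succ (n := M)]
  simp only [Fin.succ_castSucc, Fin.succ_last, Fin.castSucc_zero]
  linarith

/-- **descent of the optimal value function along the closed loop.** If a tuple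
with objective value `J` is feasible for `x`, and the control is the convex combination
`μ = Σ_j λ_j U_j u_0` of vertex inputs, then for every realization `(A,B) ∈ Δ`, `w ∈ 𝒲` of the
uncertainty, the optimal value at the successor state `x⁺ = A x + B μ + w` satisfies
`C*(x⁺) ≤ J − ‖(y_0 − y_s, u_0 − u_s)‖_Q²`. -/
theorem optimal_value_descent
    {n nu m p v q : ℕ}
    (A : Fin p → Matrix (Fin n) (Fin n) ℝ)
    (B : Fin p → Matrix (Fin n) (Fin nu) ℝ)
    (W SX : Set (Fin n → ℝ)) (SU : Set (Fin nu → ℝ))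
    (hW : Convex ℝ W) (hSX : Convex ℝ SX) (hSU : Convex ℝ SU)
    (F : Matrix (Fin m) (Fin n) ℝ)
    (E : Matrix (Fin q) (Fin m) ℝ)
    (V : Fin v → Matrix (Fin n) (Fin m) ℝ)
    (U : Fin v → Matrix (Fin nu) (Fin (v * nu)) ℝ)
    (d : Fin m → ℝ)
    (hd : ∀ w ∈ W, F.mulVec w ≤ d)
    (γ : ℝ) (hγ0 : 0 ≤ γ) (hγ1 : γ < 1)
    (N : ℕ) (hN : 1 ≤ N)
    (Q P : Matrix (Fin m ⊕ Fin (v * nu)) (Fin m ⊕ Fin (v * nu)) ℝ)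
    (hQsymm : Q.IsSymm) (hPsymm : P.IsSymm)
    (hQpsd : ∀ z : Fin m ⊕ Fin (v * nu) → ℝ, 0 ≤ z ⬝ᵥ Q.mulVec z)
    (hPpsd : ∀ z : Fin m ⊕ Fin (v * nu) → ℝ, 0 ≤ z ⬝ᵥ P.mulVec z)
    (hQP : ∀ z : Fin m ⊕ Fin (v * nu) → ℝ,
      z ⬝ᵥ Q.mulVec z + γ ^ 2 * (z ⬝ᵥ P.mulVec z) ≤ z ⬝ᵥ P.mulVec z)
    (l : (Fin m → ℝ) → (Fin (v * nu) → ℝ) → ℝ)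
    (hvert : ∀ y : Fin m → ℝ, E.mulVec y ≤ 0 →
      Xset F y = convexHull ℝ (Set.range fun j : Fin v => (V j).mulVec y))
    (x : Fin n → ℝ)
    (y : Fin (N + 1) → Fin m → ℝ) (u : Fin (N + 1) → Fin (v * nu) → ℝ)
    (ys : Fin m → ℝ) (us : Fin (v * nu) → ℝ)
    (hfeas : Feasible γ N (Sset A B SX SU F E V U d) F x y u ys us)
    (lam : Fin v → ℝ) (hlam : ∀ j, 0 ≤ lam j) (hlam1 : (∑ j, lam j) = 1)
    (hx : x = ∑ j, lam j • (V j).mulVec (y 0)) :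
    ∀ AB ∈ Delta A B, ∀ w ∈ W,
      sInf {c : EReal |
          ∃ (y' : Fin (N + 1) → Fin m → ℝ) (u' : Fin (N + 1) → Fin (v * nu) → ℝ)
            (ys' : Fin m → ℝ) (us' : Fin (v * nu) → ℝ),
            Feasible γ N (Sset A B SX SU F E V U d) F
              (AB.1.mulVec x + AB.2.mulVec (∑ j, lam j • (U j).mulVec (u 0)) + w)
              y' u' ys' us' ∧
            c = (Obj N Q P l y' u' ys' us' : EReal)}
        ≤ ((Obj N Q P l y u ys us
            - Sum.elim (y 0 - ys) (u 0 - us) ⬝ᵥ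
                Q.mulVec (Sum.elim (y 0 - ys) (u 0 - us)) : ℝ) : EReal) := by
  obtain ⟨M, rfl⟩ := Nat.exists_eq_add_of_le' hN
  intro AB hAB w hw
  have hsucc := mulVec_successor_le_of_mem_Sset (hfeas.2.2.1 0) hlam hlam1 hAB (hd w hw)
  rw [Fin.castSucc_zero, ← hx] at hsucc
  refine (sInf_le ?_).trans (EReal.coe_le_coe_iff.2 (Obj_shift_le hQP l y u ys us))
  exact ⟨_, _, ys, us,
    hfeas.shift hγ0 hγ1.le (convex_Sset A B hSX hSU F E V U d) hsucc, rfl⟩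
end
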